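/- arXiv:1205.3297 — 2 statements merged into one kernel-verified Lean document; each statement's English description precedes it below -/
import Mathlib

section
/- For every m ∈ ℕ, the set of upward closed subsets of ℕ₀ᵐ (with the componentwise order) is countably infinite. -/
/-- An operation sequence on a lattice `L`: `f n` is the `(n+1)`-ary operation,
so `f n` corresponds to the paper's `f_{n+1}`. -/
def OpSeq (L : Type) : Type := ∀ n : ℕ, (Fin (n + 1) → L) → L

/-- Admissibility: (HC1), (HC2), (HC3), (HC4), (HC7), (HC8). -/
def IsAdmissible {L : Type} [CompleteLattice L] (f : OpSeq L) : Prop :=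
  -- (HC1)
  (∀ n (α : Fin (n + 1) → L) (k : Fin (n + 1)), f n α ≤ α k) ∧
  -- (HC2) monotonicity
  (∀ n (α β : Fin (n + 1) → L), α ≤ β → f n α ≤ f n β) ∧
  -- (HC3)
  (∀ n (α : Fin (n + 2) → L), f (n + 1) α ≤ f n (fun i => α i.succ)) ∧
  -- (HC4) symmetry
  (∀ n (α : Fin (n + 1) → L) (π : Equiv.Perm (Fin (n + 1))), f n (α ∘ π) = f n α) ∧
  -- (HC7) join distributivity in each argument
  (∀ n (i : Fin (n + 1)) (α : Fin (n + 1) → L) (S : Set L),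
      f n (Function.update α i (sSup S)) = ⨆ b ∈ S, f n (Function.update α i b)) ∧
  -- (HC8)
  (∀ n k (hkn : k ≤ n) (α : Fin (n + 1) → L),
      f k (fun i : Fin (k + 1) =>
        if hi : (i : ℕ) < k then α ⟨i.1, by omega⟩
        else f (n - k) (fun j : Fin (n - k + 1) => α ⟨k + j.1, by have := j.2; omega⟩)) ≤
      f n α)

/-- `(δ, ε)` is a splitting pair. -/
def IsSplittingPair {L : Type} [Lattice L] [BoundedOrder L] (δ ε : L) : Prop :=
  δ < ⊤ ∧ ⊥ < ε ∧ ∀ α : L, ε ≤ α ∨ α ≤ δ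

/-- `L` splits. -/
def Splits (L : Type) [Lattice L] [BoundedOrder L] : Prop :=
  ∃ δ ε : L, IsSplittingPair δ ε

/-- `L` splits strongly. -/
def SplitsStrongly (L : Type) [Lattice L] [BoundedOrder L] : Prop :=
  ∃ δ ε : L, IsSplittingPair δ ε ∧ ε ≤ δ

/-- In a well-quasi-ordered countable partial order, there are only countably many upper sets,
since each is the upper closure of its finite set of minimal elements. -/
theorem countable_isUpperSet {α : Type*} [PartialOrder α] [WellQuasiOrderedLE α]
    [Countable α] : {U : Set α | IsUpperSet U}.Countable := by
  refine (Set.countable_range fun s : Finset α => (upperClosure (s : Set α) : Set α)).mono ?_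
  intro U hU
  have hfin : {x | Minimal (· ∈ U) x}.Finite :=
    WellQuasiOrderedLE.finite_of_isAntichain (setOfPred_minimal_antichain (· ∈ U))
  refine ⟨hfin.toFinset, ?_⟩
  ext x
  simp only [Set.Finite.coe_toFinset, SetLike.mem_coe, mem_upperClosure, Set.mem_ofPred_eq]
  refine ⟨fun ⟨a, ha, hax⟩ => hU hax ha.prop, fun hx => ?_⟩
  obtain ⟨a, hax, ha⟩ := exists_minimal_le_of_wellFoundedLT (· ∈ U) x hx
  exact ⟨a, ha, hax⟩

/-- An infinite partial order has infinitely many upper sets. -/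
theorem infinite_isUpperSet {α : Type*} [PartialOrder α] [Infinite α] :
    {U : Set α | IsUpperSet U}.Infinite :=
  Set.infinite_of_injective_forall_mem Set.Ici_injective fun a => isUpperSet_Ici a

theorem upperSets_countably_infinite (m : ℕ) (hm : 1 ≤ m) :
    {U : Set (Fin m → ℕ) | IsUpperSet U}.Countable ∧
    {U : Set (Fin m → ℕ) | IsUpperSet U}.Infinite := by
  have : NeZero m := ⟨by omega⟩
  exact ⟨countable_isUpperSet, infinite_isUpperSet⟩
end

section
/- Let L be a finite modular lattice. The set of admissible operation sequences on L is finite if L does not split strongly, and countably infinite if L splits strongly. -/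
/-- The value of an operation sequence on a list of arguments; the empty list is sent to `⊤`. -/
def OpSeq.onList {L : Type} [CompleteLattice L] (f : OpSeq L) : List L → L
  | [] => ⊤
  | a :: l => f l.length (a :: l).get

/-- The value of an operation sequence on a multiset of arguments. -/
noncomputable def OpSeq.onMultiset {L : Type} [CompleteLattice L] (f : OpSeq L)
    (s : Multiset L) : L :=
  f.onList s.toList

theorem List.exists_equiv_get_of_perm {L : Type*} {l l' : List L} (h : l.Perm l') :
    ∃ e : Fin l.length ≃ Fin l'.length, ∀ i, l'.get (e i) = l.get i := by
  induction h with
  | nil => exact ⟨Equiv.refl _, fun _ => rfl⟩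
  | cons a _ ih =>
    obtain ⟨e, he⟩ := ih
    refine ⟨(finSuccEquiv _).trans ((Equiv.optionCongr e).trans (finSuccEquiv _).symm),
      fun i => ?_⟩
    refine Fin.cases ?_ (fun j => ?_) i
    · simp
    · simpa using he j
  | swap a b l =>
    refine ⟨Equiv.swap (0 : Fin (l.length + 2)) 1, fun i => ?_⟩
    refine Fin.cases ?_ (fun j => Fin.cases ?_ (fun k => ?_) j) i
    · simp
    · simp
    · have h : Equiv.swap (0 : Fin (l.length + 2)) 1 k.succ.succ = k.succ.succ :=
        Equiv.swap_apply_of_ne_of_ne (Fin.succ_ne_zero _)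
          (fun h => Fin.succ_ne_zero k (Fin.succ_injective _ h))
      exact congrArg (a :: b :: l).get h
  | trans _ _ ih₁ ih₂ =>
    obtain ⟨e₁, h₁⟩ := ih₁
    obtain ⟨e₂, h₂⟩ := ih₂
    exact ⟨e₁.trans e₂, fun i => (h₂ _).trans (h₁ i)⟩

theorem List.update_get_cons {L : Type*} (a b : L) (l : List L) :
    Function.update (a :: l).get (0 : Fin (l.length + 1)) b = (b :: l).get := by
  funext i
  refine Fin.cases ?_ (fun j => ?_) i
  · simp
  · rw [Function.update_of_ne (Fin.succ_ne_zero j)]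
    rfl

namespace OpSeq

variable {L : Type} [CompleteLattice L] {f g : OpSeq L}

theorem onList_eq (f : OpSeq L) (l : List L) (n : ℕ) (h : l.length = n + 1) :
    f.onList l = f n (fun i => l[i.1]'(by omega)) := by
  cases l with
  | nil => simp at h
  | cons a l =>
    obtain rfl : l.length = n := by simpa using h
    rfl

theorem onList_ofFn (f : OpSeq L) {n : ℕ} (α : Fin (n + 1) → L) :
    f.onList (List.ofFn α) = f n α := by
  rw [onList_eq f _ n (by simp)]
  simp only [List.getElem_ofFn]

theorem onList_perm (hf : IsAdmissible f) {l l' : List L} (h : l.Perm l') :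
    f.onList l = f.onList l' := by
  obtain ⟨-, -, -, hsymm, -, -⟩ := hf
  rcases Nat.eq_zero_or_eq_succ_pred l.length with h0 | hn
  · obtain rfl := List.length_eq_zero_iff.1 h0
    rw [List.nil_perm.1 h]
  · have hn' : l'.length = l.length.pred + 1 := by rw [← h.length_eq]; exact hn
    generalize l.length.pred = n at hn hn'
    rw [onList_eq f l n hn, onList_eq f l' n hn']
    obtain ⟨e, he⟩ := List.exists_equiv_get_of_perm h
    rw [← hsymm n (fun i => l'[i.1]'(by omega))
      ((finCongr hn).symm.trans (e.trans (finCongr hn')))]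
    congr 1
    funext i
    exact (he _).symm

theorem onMultiset_coe (hf : IsAdmissible f) (l : List L) :
    f.onMultiset (l : Multiset L) = f.onList l :=
  onList_perm hf (Multiset.coe_eq_coe.1 (Multiset.coe_toList _))

theorem onMultiset_cons_le (hf : IsAdmissible f) (a : L) (s : Multiset L) :
    f.onMultiset (a ::ₘ s) ≤ f.onMultiset s := by
  induction s using Quotient.inductionOn with
  | h l =>
    change f.onMultiset ((a :: l : List L) : Multiset L) ≤ f.onMultiset (l : Multiset L)
    rw [onMultiset_coe hf, onMultiset_coe hf]
    cases l with
    | nil => exact le_top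
    | cons b l => exact hf.2.2.1 l.length (a :: b :: l).get

theorem onMultiset_antitone (hf : IsAdmissible f) : Antitone f.onMultiset := by
  intro s t h
  obtain ⟨u, rfl⟩ := Multiset.le_iff_exists_add.1 h
  induction u using Multiset.induction_on with
  | empty => simp
  | cons a u ih =>
    rw [Multiset.add_cons]
    exact (onMultiset_cons_le hf a _).trans (ih (Multiset.le_add_right _ _))

theorem onMultiset_le_of_mem (hf : IsAdmissible f) {a : L} {s : Multiset L} (h : a ∈ s) :
    f.onMultiset s ≤ a := by
  refine (onMultiset_antitone hf (Multiset.singleton_le.2 h)).trans ?_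
  rw [← Multiset.coe_singleton, onMultiset_coe hf]
  exact hf.1 0 [a].get 0

theorem onMultiset_sSup_cons (hf : IsAdmissible f) (S : Set L) (s : Multiset L) :
    f.onMultiset (sSup S ::ₘ s) = ⨆ b ∈ S, f.onMultiset (b ::ₘ s) := by
  induction s using Quotient.inductionOn with
  | h l =>
    have key (b : L) : f.onMultiset (b ::ₘ (l : Multiset L)) =
        f l.length (Function.update (⊤ :: l).get (0 : Fin (l.length + 1)) b) := by
      rw [Multiset.cons_coe, onMultiset_coe hf, List.update_get_cons]
      rfl
    change f.onMultiset (sSup S ::ₘ (l : Multiset L)) =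
      ⨆ b ∈ S, f.onMultiset (b ::ₘ (l : Multiset L))
    simp only [key]
    exact hf.2.2.2.2.1 _ _ _ _

theorem onMultiset_cons_le_iff (hf : IsAdmissible f) (a c : L) (s : Multiset L) :
    f.onMultiset (a ::ₘ s) ≤ c ↔ a ≤ sSup {x | f.onMultiset (x ::ₘ s) ≤ c} := by
  refine ⟨fun h => le_sSup h, fun h => ?_⟩
  have h1 : f.onMultiset (sSup {x | f.onMultiset (x ::ₘ s) ≤ c} ::ₘ s) ≤ c := by
    rw [onMultiset_sSup_cons hf]
    exact iSup₂_le fun b hb => hb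
  have h2 := onMultiset_sSup_cons hf {a, sSup {x | f.onMultiset (x ::ₘ s) ≤ c}} s
  rw [sSup_pair, sup_eq_right.2 h] at h2
  refine le_trans ?_ h1
  rw [h2]
  exact le_iSup₂_of_le a (by simp) le_rfl

theorem onMultiset_nested_le (hf : IsAdmissible f) (s t : Multiset L) (ht : t ≠ 0) :
    f.onMultiset (f.onMultiset t ::ₘ s) ≤ f.onMultiset (s + t) := by
  induction s using Quotient.inductionOn with
  | h l =>
  induction t using Quotient.inductionOn with
  | h l' =>
    have hl' : 0 < l'.length := by
      rw [List.length_pos_iff]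
      rintro rfl
      exact ht rfl
    change f.onMultiset (f.onMultiset (l' : Multiset L) ::ₘ (l : Multiset L)) ≤
      f.onMultiset ((l : Multiset L) + (l' : Multiset L))
    have hperm : (f.onList l' ::ₘ (l : Multiset L)) = ((l ++ [f.onList l'] : List L) : Multiset L) := by
      rw [← Multiset.coe_add, Multiset.coe_singleton, ← Multiset.singleton_add, add_comm]
    rw [onMultiset_coe hf l', hperm, Multiset.coe_add, onMultiset_coe hf, onMultiset_coe hf]
    obtain ⟨n, hn⟩ : ∃ n, (l ++ l').length = n + 1 :=
      ⟨l.length + l'.length - 1, by rw [List.length_append]; omega⟩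
    have hn2 : l.length + l'.length = n + 1 := by rw [← hn, List.length_append]
    have h8 := hf.2.2.2.2.2 n l.length (by omega) (fun i => (l ++ l')[i.1]'(by omega))
    rw [onList_eq f (l ++ l') n hn]
    refine le_trans (le_of_eq ?_) h8
    rw [onList_eq f (l ++ [f.onList l']) l.length (by simp)]
    congr 1
    funext i
    rw [List.getElem_append]
    split_ifs with hi
    · rw [List.getElem_append_left hi]
    · rw [List.getElem_singleton, onList_eq f l' (n - l.length) (by omega)]
      congr 1
      funext j
      simp

theorem eq_of_onMultiset_eq (hf : IsAdmissible f) (hg : IsAdmissible g)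
    (h : ∀ s, f.onMultiset s = g.onMultiset s) : f = g := by
  funext n α
  rw [← onList_ofFn f, ← onList_ofFn g, ← onMultiset_coe hf, ← onMultiset_coe hg, h]

end OpSeq

theorem Multiset.isPWO_of_finite {L : Type} [Finite L] (S : Set (Multiset L)) : S.IsPWO := by
  classical
  have h := (Set.isPWO_of_wellQuasiOrderedLE (Set.univ : Set (L →₀ ℕ))).image_of_monotone
    (Finsupp.orderIsoMultiset (ι := L)).monotone
  exact h.mono fun s _ => (Finsupp.orderIsoMultiset.surjective s).imp fun _ hx => ⟨trivial, hx⟩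

namespace OpSeq

variable {L : Type} [CompleteLattice L] [Finite L] {f g : OpSeq L}

theorem exists_finset_le_iff (hf : IsAdmissible f) (c : L) : ∃ B : Finset (Multiset L),
    ∀ s, f.onMultiset s ≤ c ↔ ∃ t ∈ B, t ≤ s := by
  have hpwo := Multiset.isPWO_of_finite {s : Multiset L | f.onMultiset s ≤ c}
  have hfin : {t | Minimal (· ∈ {s : Multiset L | f.onMultiset s ≤ c}) t}.Finite :=
    (setOfPred_minimal_antichain _).finite_of_partiallyWellOrderedOn
      (hpwo.mono fun t ht => ht.1)
  refine ⟨hfin.toFinset, fun s => ⟨fun h => ?_, ?_⟩⟩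
  · obtain ⟨t, hts, ht⟩ := hpwo.exists_le_minimal h
    exact ⟨t, by simpa using ht, hts⟩
  · rintro ⟨t, ht, hts⟩
    have ht' : Minimal (· ∈ {s : Multiset L | f.onMultiset s ≤ c}) t := by simpa using ht
    exact (onMultiset_antitone hf hts).trans ht'.1

theorem countable_setOf_isAdmissible : {F : OpSeq L | IsAdmissible F}.Countable := by
  choose! B hB using fun (f : OpSeq L) (hf : IsAdmissible f) (c : L) =>
    exists_finset_le_iff hf c
  have hinj : Set.InjOn B {F : OpSeq L | IsAdmissible F} := by
    intro f hf g hg h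
    refine eq_of_onMultiset_eq hf hg fun s => ?_
    refine eq_of_forall_ge_iff fun c => ?_
    rw [hB f hf, hB g hg, h]
  exact Set.MapsTo.countable_of_injOn (Set.mapsTo_univ _ _) hinj (Set.to_countable _)

theorem exists_stable [DecidableEq L] (hf : IsAdmissible f) : ∃ N : ℕ, ∀ (s : Multiset L) (a : L),
    N ≤ s.count a → f.onMultiset (a ::ₘ s) = f.onMultiset s := by
  have := Fintype.ofFinite L
  choose B hB using exists_finset_le_iff hf
  refine ⟨Finset.univ.sup fun c => (B c).sup Multiset.card, fun s a ha => ?_⟩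
  refine le_antisymm (onMultiset_cons_le hf a s) ?_
  obtain ⟨t, ht, hts⟩ := (hB _ _).1 (le_refl (f.onMultiset (a ::ₘ s)))
  refine (hB _ _).2 ⟨t, ht, Multiset.le_iff_count.2 fun b => ?_⟩
  rcases eq_or_ne b a with rfl | hb
  · refine (Multiset.count_le_card b t).trans (le_trans ?_ ha)
    exact (Finset.le_sup (f := Multiset.card) ht).trans
      (Finset.le_sup (f := fun c => (B c).sup Multiset.card) (Finset.mem_univ _))
  · simpa [Multiset.count_cons_of_ne hb] using Multiset.le_iff_count.1 hts b

theorem splitsStrongly_of_stable (hf : IsAdmissible f) {a c : L} {s : Multiset L}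
    (hstab : ∀ t, s ≤ t → f.onMultiset (a ::ₘ t) = f.onMultiset t)
    (hs : ¬ f.onMultiset s ≤ c) (haa : f.onMultiset (f.onMultiset {a, a} ::ₘ s) ≤ c) :
    SplitsStrongly L := by
  classical
  have := Fintype.ofFinite L
  set D : Multiset L → L := fun t => sSup {x | f.onMultiset (x ::ₘ t) ≤ c} with hD
  have hDiff (x : L) (t : Multiset L) : f.onMultiset (x ::ₘ t) ≤ c ↔ x ≤ D t :=
    onMultiset_cons_le_iff hf x c t
  have hDmono (x : L) (t : Multiset L) : D t ≤ D (x ::ₘ t) := by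
    rw [← hDiff, Multiset.cons_swap]
    exact (onMultiset_cons_le hf _ _).trans ((hDiff _ _).2 le_rfl)
  obtain ⟨_, ⟨C, ⟨hsC, hC⟩, rfl⟩, hmax⟩ :=
    (Set.toFinite (D '' {t | s ≤ t ∧ ¬ f.onMultiset t ≤ c})).exists_maximal
      ⟨_, s, ⟨le_rfl, hs⟩, rfl⟩
  have hext (X : Multiset L) : (∀ x ∈ X, ¬ x ≤ D C) →
      ¬ f.onMultiset (X + C) ≤ c ∧ D (X + C) = D C := by
    induction X using Multiset.induction_on with
    | empty => intro _; simpa using hC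
    | cons x X ih =>
      intro hX
      obtain ⟨-, h2⟩ := ih fun y hy => hX y (Multiset.mem_cons_of_mem hy)
      have h3 : ¬ f.onMultiset (x ::ₘ (X + C)) ≤ c := by
        rw [hDiff, h2]
        exact hX x (Multiset.mem_cons_self _ _)
      rw [Multiset.cons_add]
      have h4 : D C ≤ D (x ::ₘ (X + C)) := h2 ▸ hDmono x (X + C)
      refine ⟨h3, le_antisymm (hmax ⟨_, ⟨?_, h3⟩, rfl⟩ h4) h4⟩
      exact (hsC.trans (Multiset.le_add_left _ _)).trans (Multiset.le_cons_self _ _)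
  obtain ⟨hY, -⟩ := hext (Finset.univ.filter fun x => ¬ x ≤ D C).val (by simp)
  set Y := (Finset.univ.filter fun x => ¬ x ≤ D C).val + C with hYdef
  have haY : f.onMultiset Y ≤ D C := by
    have hsY : s ≤ Y := hsC.trans (Multiset.le_add_left _ _)
    rw [← hstab Y hsY, ← hstab (a ::ₘ Y) (hsY.trans (Multiset.le_cons_self _ _))]
    refine (onMultiset_antitone hf (?_ : {a, a} ≤ _)).trans ((hDiff _ _).1 ?_)
    · exact Multiset.cons_le_cons a (Multiset.singleton_le.2 (Multiset.mem_cons_self _ _))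
    · exact (onMultiset_antitone hf (Multiset.cons_le_cons _ hsC)).trans haa
  refine ⟨D C, D C ⊓ sInf {x | ¬ x ≤ D C}, ⟨?_, ?_, fun x => ?_⟩, inf_le_left⟩
  · refine lt_top_iff_ne_top.2 fun h => hC ?_
    rw [← hstab C hsC, hDiff, h]
    exact le_top
  · refine lt_of_lt_of_le (bot_lt_iff_ne_bot.2 fun h => hY (h.trans_le bot_le))
      (le_inf haY (le_sInf fun x hx => onMultiset_le_of_mem hf ?_))
    exact Multiset.mem_add.2 (Or.inl (by simpa using hx))
  · by_cases hx : x ≤ D C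
    · exact Or.inr hx
    · exact Or.inl (inf_le_right.trans (sInf_le hx))

theorem exists_arity_determining (hL : ¬ SplitsStrongly L) (hf : IsAdmissible f) :
    ∃ N : ℕ, ∀ g : OpSeq L, IsAdmissible g →
      (∀ n ≤ N, g n = f n) → g = f := by
  classical
  have := Fintype.ofFinite L
  obtain ⟨N, hN⟩ := exists_stable hf
  refine ⟨(N + 4) * Fintype.card L + 4, fun g hg hgf => eq_of_onMultiset_eq hg hf fun s => ?_⟩
  induction hn : Multiset.card s using Nat.strong_induction_on generalizing s with
  | _ n ih =>
  subst hn
  by_cases hcard : Multiset.card s ≤ (N + 4) * Fintype.card L + 4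
  · induction s using Quotient.inductionOn with
    | h l =>
      change g.onMultiset (l : Multiset L) = f.onMultiset (l : Multiset L)
      rw [onMultiset_coe hg, onMultiset_coe hf]
      cases l with
      | nil => rfl
      | cons b l =>
        change g l.length _ = f l.length _
        have : l.length + 1 ≤ (N + 4) * Fintype.card L + 4 := by simpa using hcard
        rw [hgf _ (by omega)]
  obtain ⟨a, ha⟩ : ∃ a, N + 4 ≤ s.count a := by
    by_contra! h
    refine hcard ?_
    rw [← Multiset.sum_count_eq_card (s := Finset.univ) (fun a _ => Finset.mem_univ a)]
    refine (Finset.sum_le_card_nsmul _ _ (N + 4) fun a _ => (h a).le).trans ?_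
    rw [smul_eq_mul, Finset.card_univ, mul_comm]
    omega
  obtain ⟨s₁, rfl⟩ := Multiset.exists_cons_of_mem (Multiset.count_pos.1 (by omega : 0 < s.count a))
  rw [Multiset.count_cons_self] at ha
  obtain ⟨s₂, rfl⟩ :=
    Multiset.exists_cons_of_mem (Multiset.count_pos.1 (by omega : 0 < s₁.count a))
  rw [Multiset.count_cons_self] at ha
  simp only [Multiset.card_cons] at ih hcard
  have hstab (t : Multiset L) (ht : s₂ ≤ t) : f.onMultiset (a ::ₘ t) = f.onMultiset t :=
    hN t a (by have := Multiset.count_le_of_le a ht; omega)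
  have h1 : f.onMultiset (a ::ₘ a ::ₘ s₂) = f.onMultiset s₂ := by
    rw [hstab _ (Multiset.le_cons_self _ _), hstab _ le_rfl]
  rw [h1]
  refine le_antisymm ?_ ?_
  · rw [← ih _ (by omega) s₂ rfl]
    exact onMultiset_antitone hg
      ((Multiset.le_cons_self _ _).trans (Multiset.le_cons_self _ _))
  · by_contra hlt
    refine hL (splitsStrongly_of_stable hf hstab hlt ?_)
    rw [← ih 2 (by omega) {a, a} rfl, ← ih (Multiset.card s₂ + 1) (by omega) _ (by simp)]
    refine (onMultiset_nested_le hg s₂ {a, a} (by simp)).trans (le_of_eq ?_)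
    rw [add_comm, Multiset.insert_eq_cons, Multiset.cons_add, Multiset.singleton_add]

theorem isClosed_setOf_isAdmissible [TopologicalSpace L] [DiscreteTopology L] :
    IsClosed (X := ∀ n : ℕ, (Fin (n + 1) → L) → L) {F : OpSeq L | IsAdmissible F} := by
  have hc (n : ℕ) : Continuous (fun F : ∀ n : ℕ, (Fin (n + 1) → L) → L => F n) :=
    continuous_apply n
  have h1 (n : ℕ) (P : ((Fin (n + 1) → L) → L) → Prop) :
      IsClosed {F : ∀ n : ℕ, (Fin (n + 1) → L) → L | P (F n)} :=
    (isClosed_discrete {x | P x}).preimage (hc n)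
  have h3 (n m k : ℕ) (P : ((Fin (n + 1) → L) → L) → ((Fin (m + 1) → L) → L) →
      ((Fin (k + 1) → L) → L) → Prop) :
      IsClosed {F : ∀ n : ℕ, (Fin (n + 1) → L) → L | P (F n) (F m) (F k)} :=
    (isClosed_discrete {x : _ × _ × _ | P x.1 x.2.1 x.2.2}).preimage
      ((hc n).prodMk ((hc m).prodMk (hc k)))
  have hall {ι : Type} {P : ι → (∀ n : ℕ, (Fin (n + 1) → L) → L) → Prop}
      (h : ∀ i, IsClosed {F | P i F}) : IsClosed {F | ∀ i, P i F} := by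
    simpa only [Set.ofPred_forall] using isClosed_iInter h
  refine .and ?_ (.and ?_ (.and ?_ (.and ?_ (.and ?_ ?_))))
  · exact hall fun n => hall fun α => hall fun k =>
      h1 n fun x => x α ≤ α k
  · exact hall fun n => hall fun α => hall fun β =>
      h1 n fun x => α ≤ β → x α ≤ x β
  · exact hall fun n => hall fun α =>
      h3 (n + 1) n n fun x y _ => x α ≤ y fun i => α i.succ
  · exact hall fun n => hall fun α => hall fun π =>
      h1 n fun x => x (α ∘ π) = x α
  · exact hall fun n => hall fun i => hall fun α =>
      hall fun S => h1 n fun x =>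
        x (Function.update α i (sSup S)) = ⨆ b ∈ S, x (Function.update α i b)
  · refine hall fun n => hall fun k => ?_
    by_cases hkn : k ≤ n
    · simp only [hkn, forall_true_left]
      exact hall fun α => h3 k (n - k) n fun x y z =>
        x (fun i : Fin (k + 1) =>
          if hi : (i : ℕ) < k then α ⟨i.1, by omega⟩
          else y (fun j : Fin (n - k + 1) => α ⟨k + j.1, by have := j.2; omega⟩)) ≤ z α
    · simp [hkn]

theorem finite_setOf_isAdmissible (hL : ¬ SplitsStrongly L) :
    {F : OpSeq L | IsAdmissible F}.Finite := by
  let _ : TopologicalSpace L := ⊥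
  have : DiscreteTopology L := ⟨rfl⟩
  let _ : TopologicalSpace (OpSeq L) :=
    inferInstanceAs (TopologicalSpace (∀ n : ℕ, (Fin (n + 1) → L) → L))
  have : CompactSpace (OpSeq L) :=
    inferInstanceAs (CompactSpace (∀ n : ℕ, (Fin (n + 1) → L) → L))
  have hcl : IsClosed {F : OpSeq L | IsAdmissible F} := isClosed_setOf_isAdmissible
  refine hcl.isCompact.finite ?_
  rw [isDiscrete_iff_forall_mem_exists_isOpen]
  intro f hf
  obtain ⟨N, hN⟩ := exists_arity_determining hL hf
  refine ⟨⋂ n ∈ Set.Iic N, {g : OpSeq L | g n = f n}, ?_, ?_⟩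
  · refine (Set.finite_Iic N).isOpen_biInter fun n _ => ?_
    exact (isOpen_discrete {f n}).preimage
      (continuous_apply n : Continuous fun F : ∀ n : ℕ, (Fin (n + 1) → L) → L => F n)
  · ext g
    simp only [Set.mem_inter_iff, Set.mem_iInter, Set.mem_Iic, Set.mem_ofPred_eq,
      Set.mem_singleton_iff]
    refine ⟨fun h => hN g h.2 h.1, ?_⟩
    rintro rfl
    exact ⟨fun _ _ => rfl, hf⟩

end OpSeq

open Classical in
/-- The operation sequence with value `ε` on tuples of at most `N + 1` elements not below `δ`,
and `⊥` on all other tuples. -/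
noncomputable def OpSeq.truncated {L : Type} [CompleteLattice L] (δ ε : L) (N : ℕ) : OpSeq L :=
  fun n α => if n ≤ N ∧ ∀ i, ¬ α i ≤ δ then ε else ⊥

namespace OpSeq

variable {L : Type} [CompleteLattice L] {δ ε : L}

theorem truncated_le {N n : ℕ} {α : Fin (n + 1) → L} {c : L} :
    truncated δ ε N n α ≤ c ↔ (n ≤ N → (∀ i, ¬ α i ≤ δ) → ε ≤ c) := by
  unfold truncated
  split_ifs with h
  · simp [h.1, h.2]
  · simp only [bot_le, true_iff]
    exact fun h1 h2 => absurd ⟨h1, h2⟩ h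

theorem le_truncated {N n : ℕ} {α : Fin (n + 1) → L} (hn : n ≤ N) (h : ∀ i, ¬ α i ≤ δ) :
    ε ≤ truncated δ ε N n α :=
  (if_pos ⟨hn, h⟩).ge

theorem isAdmissible_truncated (h : IsSplittingPair δ ε) (hεδ : ε ≤ δ) (N : ℕ) :
    IsAdmissible (truncated δ ε N) := by
  have hmono (n : ℕ) (α β : Fin (n + 1) → L) (hαβ : α ≤ β) :
      truncated δ ε N n α ≤ truncated δ ε N n β :=
    truncated_le.2 fun hn hα => le_truncated hn fun i hi => hα i ((hαβ i).trans hi)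
  refine ⟨fun n α k => truncated_le.2 fun _ hα => (h.2.2 _).resolve_right (hα k), hmono,
    fun n α => truncated_le.2 fun hn hα => le_truncated (by omega) fun i => hα _,
    fun n α π => le_antisymm ?_ ?_, fun n i α S => le_antisymm ?_ ?_, fun n k hkn α => ?_⟩
  · exact truncated_le.2 fun hn hα => le_truncated hn fun i => by simpa using hα (π.symm i)
  · exact truncated_le.2 fun hn hα => le_truncated hn fun i => hα (π i)
  · refine truncated_le.2 fun hn hα => ?_
    have hS : ¬ sSup S ≤ δ := by simpa using hα i
    obtain ⟨b, hb, hbδ⟩ : ∃ b ∈ S, ¬ b ≤ δ := by simpa using hS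
    refine le_iSup₂_of_le b hb (le_truncated hn fun j => ?_)
    rcases eq_or_ne j i with rfl | hj
    · simpa using hbδ
    · simpa [hj] using hα j
  · refine iSup₂_le fun b hb => hmono _ _ _ ?_
    exact update_le_update_iff.2 ⟨le_sSup hb, fun _ _ => le_rfl⟩
  · refine truncated_le.2 fun _ hα => absurd ?_ (hα (Fin.last k))
    rw [dif_neg (by simp)]
    exact truncated_le.2 fun _ _ => hεδ

theorem infinite_setOf_isAdmissible (hL : SplitsStrongly L) :
    {F : OpSeq L | IsAdmissible F}.Infinite := by
  obtain ⟨δ, ε, h, hεδ⟩ := hL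
  refine Set.infinite_of_injective_forall_mem (f := truncated δ ε) ?_
    (isAdmissible_truncated h hεδ)
  have hle (M N : ℕ) (hMN : truncated δ ε M = truncated δ ε N) : M ≤ N := by
    by_contra hlt
    have h1 : ε ≤ truncated δ ε N M fun _ => ⊤ :=
      hMN ▸ le_truncated le_rfl fun _ => h.1.not_ge
    have h2 : truncated δ ε N M (fun _ => ⊤) ≤ ⊥ := truncated_le.2 fun hM => absurd hM hlt
    exact h.2.1.not_ge (h1.trans h2)
  exact fun M N hMN => le_antisymm (hle M N hMN) (hle N M hMN.symm)

end OpSeq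

theorem cardinality_of_admissible_sequences (L : Type) [CompleteLattice L] [Finite L]
    [IsModularLattice L] :
    (¬ SplitsStrongly L → {F : OpSeq L | IsAdmissible F}.Finite) ∧
    (SplitsStrongly L → {F : OpSeq L | IsAdmissible F}.Countable ∧
      {F : OpSeq L | IsAdmissible F}.Infinite) :=
  ⟨OpSeq.finite_setOf_isAdmissible, fun h =>
    ⟨OpSeq.countable_setOf_isAdmissible, OpSeq.infinite_setOf_isAdmissible h⟩⟩
end
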